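/- arXiv:2509.05101 — 4 statements merged into one kernel-verified Lean document; each statement's English description precedes it below -/
import Mathlib

section
/- Let L be a connected simple graph with finite vertex set V and let A_L be the associated right-angled Artin group. Then for all vertices x, y ∈ V and every integer a, the element (of x)^a · (of y)^{-a} lies in the subgroup of A_L generated by S = { of u · (of v)⁻¹ : u, v adjacent in L }. -/
/-- The relators of the right-angled Artin group associated to a simple graph:
commutators of pairs of adjacent vertices. -/
def raagRels {V : Type*} (L : SimpleGraph V) : Set (FreeGroup V) :=
  {r | ∃ x y, L.Adj x y ∧
    r = FreeGroup.of x * FreeGroup.of y * (FreeGroup.of x)⁻¹ * (FreeGroup.of y)⁻¹}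

/-- The right-angled Artin group associated to a simple graph. -/
abbrev RAAG {V : Type*} (L : SimpleGraph V) : Type _ := PresentedGroup (raagRels L)

/-- The generators of a right-angled Artin group at adjacent vertices commute. -/
theorem RAAG.commute_of_adj {V : Type*} {L : SimpleGraph V} {u v : V} (h : L.Adj u v) :
    Commute (PresentedGroup.of (rels := raagRels L) u) (PresentedGroup.of v) := by
  have hr := PresentedGroup.one_of_mem (rels := raagRels L) ⟨u, v, h, rfl⟩
  simp only [map_mul, map_inv] at hr
  exact mul_inv_eq_iff_eq_mul.mp (mul_inv_eq_one.mp hr)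

theorem stmt6 {V : Type*} [Finite V] (L : SimpleGraph V) (hconn : L.Connected)
    (x y : V) (a : ℤ) :
    (PresentedGroup.of (rels := raagRels L) x) ^ a *
        (PresentedGroup.of (rels := raagRels L) y) ^ (-a) ∈
      Subgroup.closure {g : RAAG L | ∃ u v, L.Adj u v ∧
        g = PresentedGroup.of u * (PresentedGroup.of v)⁻¹} := by
  obtain ⟨p⟩ := hconn.preconnected x y
  induction p with
  | nil => simp
  | @cons u v w h _ ih =>
    have key : (PresentedGroup.of u * (PresentedGroup.of v)⁻¹) ^ a ∈
        Subgroup.closure {g : RAAG L | ∃ u v, L.Adj u v ∧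
          g = PresentedGroup.of u * (PresentedGroup.of v)⁻¹} :=
      zpow_mem (Subgroup.subset_closure (by exact ⟨u, v, h, rfl⟩)) a
    rw [(RAAG.commute_of_adj h).inv_right.mul_zpow] at key
    simpa [mul_assoc] using mul_mem key ih
end

section
/- Let L be a connected simple graph with finite vertex set V, let A_L be the associated right-angled Artin group, let φ : A_L → ℤ be the unique homomorphism sending each generator of v (v ∈ V) to 1, and let H_L = ker φ be the Bestvina–Brady group. Then H_L is generated by the set S = { of x · (of y)⁻¹ : x, y adjacent in L }; that is, the subgroup of A_L generated by S equals ker φ. -/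
namespace RAAG

/-- The differences of adjacent generators of a right-angled Artin group. -/
def edgeSet {V : Type*} (L : SimpleGraph V) : Set (RAAG L) :=
  {g | ∃ x y, L.Adj x y ∧ g = PresentedGroup.of x * (PresentedGroup.of y)⁻¹}

variable {V : Type*} {L : SimpleGraph V}

theorem commute_of_adj_s7 {x y : V} (h : L.Adj x y) :
    Commute (PresentedGroup.of x : RAAG L) (PresentedGroup.of y) := by
  have hr : PresentedGroup.mk (raagRels L) (FreeGroup.of x * FreeGroup.of y *
      (FreeGroup.of x)⁻¹ * (FreeGroup.of y)⁻¹) = 1 :=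
    PresentedGroup.one_of_mem ⟨x, y, h, rfl⟩
  simp only [map_mul, map_inv] at hr
  exact mul_inv_eq_iff_eq_mul.mp (mul_inv_eq_one.mp hr)

theorem of_mul_inv_mem_closure_and_inv_mul_mem_closure {v x : V} (h : L.Reachable v x) :
    (PresentedGroup.of v * (PresentedGroup.of x)⁻¹ : RAAG L) ∈ Subgroup.closure (edgeSet L) ∧
      ((PresentedGroup.of v)⁻¹ * PresentedGroup.of x : RAAG L) ∈
        Subgroup.closure (edgeSet L) := by
  obtain ⟨p⟩ := h
  induction p with
  | nil => simp [one_mem]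
  | @cons a b c hab _ ih =>
    have h₁ : (PresentedGroup.of a * (PresentedGroup.of b)⁻¹ : RAAG L) ∈
        Subgroup.closure (edgeSet L) := Subgroup.subset_closure ⟨a, b, hab, rfl⟩
    have h₂ : ((PresentedGroup.of a)⁻¹ * PresentedGroup.of b : RAAG L) ∈
        Subgroup.closure (edgeSet L) := by
      rw [(commute_of_adj_s7 hab).inv_left.eq]
      exact Subgroup.subset_closure ⟨b, a, hab.symm, rfl⟩
    constructor
    · simpa [mul_assoc] using mul_mem h₁ ih.1
    · simpa [mul_assoc] using mul_mem h₂ ih.2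

theorem closure_edgeSet_normal (hL : L.Preconnected) :
    (Subgroup.closure (edgeSet L)).Normal := by
  set N := Subgroup.closure (edgeSet L)
  have conj_mem {g : RAAG L} (hg : ∀ s ∈ edgeSet L, g * s * g⁻¹ ∈ N) :
      ∀ n ∈ N, g * n * g⁻¹ ∈ N := by
    have : N ≤ N.comap (MulAut.conj g).toMonoidHom := by
      refine (Subgroup.closure_le _).mpr fun s hs => ?_
      simpa using hg s hs
    intro n hn
    simpa using this hn
  have key (v : V) : PresentedGroup.of v ∈ Subgroup.normalizer (N : Set (RAAG L)) := by
    have hpos : ∀ n ∈ N, PresentedGroup.of v * n * (PresentedGroup.of v)⁻¹ ∈ N := by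
      refine conj_mem ?_
      rintro s ⟨x, y, hxy, rfl⟩
      have hs : (PresentedGroup.of x * (PresentedGroup.of y)⁻¹ : RAAG L) ∈ N :=
        Subgroup.subset_closure ⟨x, y, hxy, rfl⟩
      have hc : Commute (PresentedGroup.of x : RAAG L)
          (PresentedGroup.of x * (PresentedGroup.of y)⁻¹) :=
        (Commute.refl _).mul_right (commute_of_adj_s7 hxy).inv_right
      have hv := (of_mul_inv_mem_closure_and_inv_mul_mem_closure (hL v x)).1
      have := mul_mem (mul_mem hv hs) (inv_mem hv)
      rw [← hc.mul_inv_cancel] at this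
      simpa [mul_assoc] using this
    have hneg : ∀ n ∈ N, (PresentedGroup.of v)⁻¹ * n * (PresentedGroup.of v)⁻¹⁻¹ ∈ N := by
      refine conj_mem ?_
      rintro s ⟨x, y, hxy, rfl⟩
      have hs : (PresentedGroup.of x * (PresentedGroup.of y)⁻¹ : RAAG L) ∈ N :=
        Subgroup.subset_closure ⟨x, y, hxy, rfl⟩
      have hc : Commute (PresentedGroup.of x : RAAG L)
          (PresentedGroup.of x * (PresentedGroup.of y)⁻¹) :=
        (Commute.refl _).mul_right (commute_of_adj_s7 hxy).inv_right
      have hv := (of_mul_inv_mem_closure_and_inv_mul_mem_closure (hL v x)).2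
      have := mul_mem (mul_mem hv hs) (inv_mem hv)
      rw [← hc.inv_mul_cancel] at this
      simpa [mul_assoc] using this
    rw [Subgroup.mem_normalizer_iff]
    refine fun n => ⟨hpos n, fun hn => ?_⟩
    simpa [mul_assoc] using hneg _ hn
  rw [← Subgroup.normalizer_eq_top_iff, eq_top_iff,
    ← PresentedGroup.closure_range_of (raagRels L), Subgroup.closure_le]
  rintro _ ⟨v, rfl⟩
  exact key v

end RAAG

theorem stmt7 {V : Type*} [Finite V] (L : SimpleGraph V) (hconn : L.Connected)
    (φ : RAAG L →* Multiplicative ℤ)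
    (hφ : ∀ v : V, φ (PresentedGroup.of v) = Multiplicative.ofAdd 1) :
    Subgroup.closure {g : RAAG L | ∃ x y, L.Adj x y ∧
        g = PresentedGroup.of x * (PresentedGroup.of y)⁻¹}
      = φ.ker := by
  change Subgroup.closure (RAAG.edgeSet L) = φ.ker
  apply le_antisymm
  · rw [Subgroup.closure_le]
    rintro _ ⟨x, y, -, rfl⟩
    simp [MonoidHom.mem_ker, hφ]
  · have := RAAG.closure_edgeSet_normal hconn.preconnected
    obtain ⟨v₀⟩ := hconn.nonempty
    let q := QuotientGroup.mk' (Subgroup.closure (RAAG.edgeSet L))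
    have hq : (zpowersHom _ (q (PresentedGroup.of v₀))).comp φ = q := by
      ext v
      have hv := (RAAG.of_mul_inv_mem_closure_and_inv_mul_mem_closure
        (hconn.preconnected v₀ v)).2
      simpa [hφ, q] using QuotientGroup.eq.mpr hv
    intro g hg
    rw [← QuotientGroup.eq_one_iff]
    change q g = 1
    rw [← hq, MonoidHom.comp_apply, MonoidHom.mem_ker.mp hg, map_one]
end

section
/- Let F be a finite field with q elements and let n ≥ 3 be an integer with gcd(n, q − 1) = 1. Then the normal core of the image of ι : SL_n(F) → SL_n(F[t, t⁻¹]) (the intersection of all conjugates of ι(SL_n(F)) in SL_n(F[t, t⁻¹])) is the trivial subgroup. -/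
open LaurentPolynomial in
/-- A constant matrix all of whose conjugates by elementary matrices `1 + t E i j` are again
constant commutes with the matrix units `E i j`. -/
theorem commute_single_of_transvection_conj_constant {F ι : Type*} [Field F] [Fintype ι]
    [DecidableEq ι] (A B : Matrix ι ι F) (i j : ι)
    (h : Matrix.transvection i j (T 1 : LaurentPolynomial F) * A.map C =
      B.map C * Matrix.transvection i j (T 1 : LaurentPolynomial F)) :
    Commute (Matrix.single i j 1) A := by
  have hsingle : Matrix.single i j (T 1 : LaurentPolynomial F) =
      (T 1 : LaurentPolynomial F) • (Matrix.single i j (1 : F)).map C := by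
    rw [Matrix.map_single _ _ _ C, map_one, Matrix.smul_single, smul_eq_mul, mul_one]
  simp only [Matrix.transvection, add_mul, mul_add, one_mul, mul_one, hsingle, Matrix.smul_mul,
    Matrix.mul_smul, ← Matrix.map_mul] at h
  have hentry (k l : ι) : A k l = B k l ∧
      (Matrix.single i j 1 * A : Matrix ι ι F) k l = (B * Matrix.single i j 1 : Matrix ι ι F) k l := by
    have hkl := congrFun (congrFun h k) l
    simp only [Matrix.add_apply, Matrix.smul_apply, Matrix.map_apply, smul_eq_mul, T_mul,
      ← single_eq_C_mul_T] at hkl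
    simp only [← single_eq_C] at hkl
    have h0 := congrArg (fun p => p.coeff 0) hkl
    have h1 := congrArg (fun p => p.coeff 1) hkl
    exact ⟨by simpa [-single_eq_C_mul_T] using h0, by simpa [-single_eq_C_mul_T] using h1⟩
  obtain rfl : A = B := Matrix.ext fun k l => (hentry k l).1
  exact Matrix.ext fun k l => (hentry k l).2

theorem stmt9 {F : Type*} [Field F] [Fintype F] (n : ℕ) (hn : 3 ≤ n)
    (hgcd : Nat.gcd n (Fintype.card F - 1) = 1) :
    (Matrix.SpecialLinearGroup.map (n := Fin n)
        (LaurentPolynomial.C : F →+* LaurentPolynomial F)).range.normalCore = ⊥ := by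
  rw [eq_bot_iff]
  intro M hM
  obtain ⟨A, rfl⟩ := Subgroup.normalCore_le _ hM
  have hcomm : Pairwise fun i j => Commute (Matrix.single i j 1) (A : Matrix (Fin n) (Fin n) F) := by
    intro i j hij
    let g : Matrix.SpecialLinearGroup (Fin n) (LaurentPolynomial F) :=
      .transvection hij (LaurentPolynomial.T 1)
    obtain ⟨B, hB⟩ := MonoidHom.mem_range.1 (hM g)
    have hBg := eq_mul_inv_iff_mul_eq.1 hB
    have hval := congrArg (Matrix.SpecialLinearGroup.coeMonoidHom) hBg
    rw [map_mul, map_mul] at hval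
    exact commute_single_of_transvection_conj_constant A.val B.val i j hval.symm
  obtain ⟨a, ha⟩ := Matrix.mem_range_scalar_of_commute_single hcomm
  have han : a ^ n = 1 := by
    have := A.det_coe
    rw [← ha] at this
    simpa using this
  have ha0 : a ≠ 0 := by
    rintro rfl
    simp [show n ≠ 0 by omega] at han
  have ha1 : a = 1 := by
    have := pow_gcd_eq_one.2 ⟨han, FiniteField.pow_card_sub_one_eq_one a ha0⟩
    rwa [hgcd, pow_one] at this
  have hA : A = 1 := Subtype.ext (by rw [← ha, ha1, map_one]; rfl)
  rw [hA, map_one]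
  exact one_mem _
end

section
/- Let F be a finite field and let n ≥ 3 be an integer. Then the conjugates of ι(SL_n(F)) generate the entire group SL_n(F[t, t⁻¹]); that is, the normal closure of the image of ι : SL_n(F) → SL_n(F[t, t⁻¹]) equals SL_n(F[t, t⁻¹]). -/
namespace Matrix.SpecialLinearGroup

variable {ι R : Type*} [Fintype ι] [DecidableEq ι] [CommRing R]

/-- `M` agrees with the identity matrix on all rows and columns indexed by `S`. -/
def IsOneOn (S : Finset ι) (M : SpecialLinearGroup ι R) : Prop :=
  ∀ i ∈ S, ∀ k, M i k = (1 : Matrix ι ι R) i k ∧ M k i = (1 : Matrix ι ι R) k i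

lemma transvection_mul_apply {i j : ι} (h : i ≠ j) (c : R) (M : SpecialLinearGroup ι R)
    (a b : ι) :
    (transvection h c * M) a b = if a = i then M i b + c * M j b else M a b := by
  change (Matrix.transvection i j c * M.1) a b = _
  split_ifs with ha
  · subst ha
    exact Matrix.transvection_mul_apply_same ..
  · exact Matrix.transvection_mul_apply_of_ne _ _ _ _ ha ..

lemma mul_transvection_apply {i j : ι} (h : i ≠ j) (c : R) (M : SpecialLinearGroup ι R)
    (a b : ι) :
    (M * transvection h c) a b = if b = j then M a j + c * M a i else M a b := by
  change (M.1 * Matrix.transvection i j c) a b = _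
  split_ifs with hb
  · subst hb
    exact Matrix.mul_transvection_apply_same ..
  · exact Matrix.mul_transvection_apply_of_ne _ _ _ _ hb ..

lemma IsOneOn.transvection_mul {S : Finset ι} {M : SpecialLinearGroup ι R} (hM : IsOneOn S M)
    {i j : ι} (hi : i ∉ S) (hj : j ∉ S) (h : i ≠ j) (c : R) :
    IsOneOn S (transvection h c * M) := by
  intro a ha b
  have hai : a ≠ i := by rintro rfl; exact hi ha
  have haj : a ≠ j := by rintro rfl; exact hj ha
  rw [transvection_mul_apply, transvection_mul_apply, if_neg hai]
  refine ⟨(hM a ha b).1, ?_⟩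
  split_ifs with hb
  · subst hb
    simp [(hM a ha b).2, (hM a ha j).2, one_apply_ne haj.symm]
  · exact (hM a ha b).2

lemma IsOneOn.mul_transvection {S : Finset ι} {M : SpecialLinearGroup ι R} (hM : IsOneOn S M)
    {i j : ι} (hi : i ∉ S) (hj : j ∉ S) (h : i ≠ j) (c : R) :
    IsOneOn S (M * transvection h c) := by
  intro a ha b
  have hai : a ≠ i := by rintro rfl; exact hi ha
  have haj : a ≠ j := by rintro rfl; exact hj ha
  rw [mul_transvection_apply, mul_transvection_apply, if_neg haj]
  refine ⟨?_, (hM a ha b).2⟩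
  split_ifs with hb
  · subst hb
    simp [(hM a ha i).1, (hM a ha b).1, one_apply_ne hai]
  · exact (hM a ha b).1

lemma isUnit_of_forall_dvd_col {M : SpecialLinearGroup ι R} {u : R} {j : ι}
    (h : ∀ k, u ∣ M k j) : IsUnit u := by
  have h1 : (M⁻¹ * M) j j = 1 := by simp
  have h2 : (M⁻¹ * M) j j = ∑ k, M⁻¹ j k * M k j := by
    rw [coe_mul, Matrix.mul_apply]
  rw [isUnit_iff_dvd_one, ← h1, h2]
  exact Finset.dvd_sum fun k _ => (h k).mul_left _

section Reduction

variable {N : Subgroup (SpecialLinearGroup ι R)}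
  (hN : ∀ (i j : ι) (h : i ≠ j) (c : R), transvection h c ∈ N)
include hN

/-- The Euclidean algorithm produces a unit in the `j`-th column. -/
lemma exists_isUnit_col [Nontrivial R] {d : R → ℕ}
    (hd : ∀ a b : R, b ≠ 0 → ∃ q, a - q * b = 0 ∨ d (a - q * b) < d b)
    {S : Finset ι} {j : ι} (hj : j ∉ S) {M : SpecialLinearGroup ι R} (hM : IsOneOn S M) :
    ∃ M' : SpecialLinearGroup ι R, (M' ∈ N → M ∈ N) ∧ IsOneOn S M' ∧
      ∃ i ∉ S, IsUnit (M' i j) := by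
  classical
  have zero_of_mem {M' : SpecialLinearGroup ι R} (hM' : IsOneOn S M') {k : ι} (hk : k ∈ S) :
      M' k j = 0 := by
    rw [(hM' k hk j).1, one_apply_ne]
    rintro rfl
    exact hj hk
  let P : ℕ → Prop := fun m => ∃ M' : SpecialLinearGroup ι R, (M' ∈ N → M ∈ N) ∧
    IsOneOn S M' ∧ ∃ i ∉ S, M' i j ≠ 0 ∧ d (M' i j) = m
  have hP : ∃ m, P m := by
    by_contra! hcon
    refine not_isUnit_zero (M₀ := R) (isUnit_of_forall_dvd_col (M := M) (j := j) fun k => ?_)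
    rw [zero_dvd_iff]
    by_contra hk
    exact hcon _ ⟨M, id, hM, k, fun hkS => hk (zero_of_mem hM hkS), hk, rfl⟩
  obtain ⟨M', hMN, hM', i, hi, hne, hdi⟩ := Nat.find_spec hP
  refine ⟨M', hMN, hM', i, hi, isUnit_of_forall_dvd_col (M := M') (j := j) fun k => ?_⟩
  by_cases hkS : k ∈ S
  · simp [zero_of_mem hM' hkS]
  rcases eq_or_ne k i with rfl | hki
  · exact dvd_rfl
  obtain ⟨q, hq⟩ := hd (M' k j) (M' i j) hne
  by_cases h0 : M' k j - q * M' i j = 0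
  · exact ⟨q, by rw [sub_eq_zero.1 h0, mul_comm]⟩
  refine absurd (hq.resolve_left h0) (not_lt.2 ?_)
  rw [hdi]
  have hent : (transvection hki (-q) * M') k j = M' k j - q * M' i j := by
    rw [transvection_mul_apply, if_pos rfl]
    ring
  refine Nat.find_min' hP ⟨transvection hki (-q) * M',
    fun h => hMN ((N.mul_mem_cancel_left (hN _ _ _ _)).1 h),
    hM'.transvection_mul hkS hi hki _, k, hkS, ?_, ?_⟩
  · rwa [hent]
  · rw [hent]

lemma exists_apply_self_eq_one_of_ne {S : Finset ι} {i j : ι} (hi : i ∉ S) (hj : j ∉ S)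
    (hij : j ≠ i) {M : SpecialLinearGroup ι R} (hM : IsOneOn S M) (hu : IsUnit (M i j)) :
    ∃ M' : SpecialLinearGroup ι R, (M' ∈ N → M ∈ N) ∧ IsOneOn S M' ∧ M' j j = 1 := by
  obtain ⟨v, hv⟩ := hu.exists_left_inv
  refine ⟨transvection hij ((1 - M j j) * v) * M, (N.mul_mem_cancel_left (hN _ _ _ _)).1,
    hM.transvection_mul hj hi hij _, ?_⟩
  rw [transvection_mul_apply, if_pos rfl, mul_assoc, hv]
  ring

lemma exists_apply_self_eq_one {S : Finset ι} {i j k : ι} (hi : i ∉ S) (hj : j ∉ S)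
    (hk : k ∉ S) (hjk : j ≠ k) {M : SpecialLinearGroup ι R} (hM : IsOneOn S M)
    (hu : IsUnit (M i j)) :
    ∃ M' : SpecialLinearGroup ι R, (M' ∈ N → M ∈ N) ∧ IsOneOn S M' ∧ M' j j = 1 := by
  rcases eq_or_ne j i with rfl | hij
  · obtain ⟨v, hv⟩ := hu.exists_left_inv
    obtain ⟨M', h1, h2, h3⟩ := exists_apply_self_eq_one_of_ne hN hk hj hjk
      (hM.transvection_mul hk hj hjk.symm ((1 - M k j) * v)) (by
        rw [transvection_mul_apply, if_pos rfl, mul_assoc, hv]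
        simp)
    exact ⟨M', fun h => (N.mul_mem_cancel_left (hN _ _ _ _)).1 (h1 h), h2, h3⟩
  · exact exists_apply_self_eq_one_of_ne hN hi hj hij hM hu

lemma exists_col_eq_one {S : Finset ι} {j : ι} (hj : j ∉ S) {M : SpecialLinearGroup ι R}
    (hM : IsOneOn S M) (h1 : M j j = 1) :
    ∃ M' : SpecialLinearGroup ι R, (M' ∈ N → M ∈ N) ∧ IsOneOn S M' ∧
      ∀ k, M' k j = (1 : Matrix ι ι R) k j := by
  have key (T : Finset ι) : ∃ M' : SpecialLinearGroup ι R, (M' ∈ N → M ∈ N) ∧ IsOneOn S M' ∧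
      M' j j = 1 ∧ ∀ k ∈ T, M' k j = (1 : Matrix ι ι R) k j := by
    induction T using Finset.induction_on with
    | empty => exact ⟨M, id, hM, h1, by simp⟩
    | insert a T _ ih =>
      obtain ⟨M', hMN, hM', hjj, hT⟩ := ih
      by_cases ha : M' a j = (1 : Matrix ι ι R) a j
      · exact ⟨M', hMN, hM', hjj, by simpa [ha] using hT⟩
      have haS : a ∉ S := fun h => ha (hM' a h j).1
      have haj : a ≠ j := by
        rintro rfl
        simp [hjj] at ha
      refine ⟨transvection haj (-M' a j) * M',
        fun h => hMN ((N.mul_mem_cancel_left (hN _ _ _ _)).1 h),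
        hM'.transvection_mul haS hj haj _, ?_, fun k hk => ?_⟩
      · rw [transvection_mul_apply, if_neg haj.symm, hjj]
      · rw [transvection_mul_apply]
        split_ifs with hka
        · subst hka
          simp [hjj, one_apply_ne haj]
        · exact hT k ((Finset.mem_insert.1 hk).resolve_left hka)
  obtain ⟨M', hMN, hM', -, hT⟩ := key Finset.univ
  exact ⟨M', hMN, hM', fun k => hT k (Finset.mem_univ k)⟩

lemma exists_isOneOn_insert {S : Finset ι} {j : ι} (hj : j ∉ S) {M : SpecialLinearGroup ι R}
    (hM : IsOneOn S M) (hcol : ∀ k, M k j = (1 : Matrix ι ι R) k j) :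
    ∃ M' : SpecialLinearGroup ι R, (M' ∈ N → M ∈ N) ∧ IsOneOn (insert j S) M' := by
  have key (T : Finset ι) : ∃ M' : SpecialLinearGroup ι R, (M' ∈ N → M ∈ N) ∧ IsOneOn S M' ∧
      (∀ k, M' k j = (1 : Matrix ι ι R) k j) ∧ ∀ k ∈ T, M' j k = (1 : Matrix ι ι R) j k := by
    induction T using Finset.induction_on with
    | empty => exact ⟨M, id, hM, hcol, by simp⟩
    | insert a T _ ih =>
      obtain ⟨M', hMN, hM', hj', hT⟩ := ih
      by_cases ha : M' j a = (1 : Matrix ι ι R) j a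
      · exact ⟨M', hMN, hM', hj', by simpa [ha] using hT⟩
      have haS : a ∉ S := fun h => ha (hM' a h j).2
      have hja : j ≠ a := by
        rintro rfl
        exact ha (hj' _)
      refine ⟨M' * transvection hja (-M' j a),
        fun h => hMN ((N.mul_mem_cancel_right (hN _ _ _ _)).1 h),
        hM'.mul_transvection hj haS hja _, fun k => ?_, fun k hk => ?_⟩
      · rw [mul_transvection_apply, if_neg hja, hj']
      · rw [mul_transvection_apply]
        split_ifs with hka
        · subst hka
          simp [hj', one_apply_ne hja]
        · exact hT k ((Finset.mem_insert.1 hk).resolve_left hka)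
  obtain ⟨M', hMN, hM', hj', hT⟩ := key Finset.univ
  refine ⟨M', hMN, fun i hi k => ?_⟩
  rcases Finset.mem_insert.1 hi with rfl | hi
  · exact ⟨hT k (Finset.mem_univ k), hj' k⟩
  · exact hM' i hi k

lemma mem_of_isOneOn [Nontrivial R] {d : R → ℕ}
    (hd : ∀ a b : R, b ≠ 0 → ∃ q, a - q * b = 0 ∨ d (a - q * b) < d b)
    (S : Finset ι) (M : SpecialLinearGroup ι R) (hM : IsOneOn S M) : M ∈ N := by
  induction hm : Sᶜ.card using Nat.strong_induction_on generalizing S M with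
  | _ m ih =>
  subst hm
  rcases Finset.eq_empty_or_nonempty Sᶜ with hS | ⟨j, hj⟩
  · have hone : M = 1 := by
      ext a b
      simpa using (hM a (by simp [Finset.compl_eq_empty_iff _ |>.1 hS]) b).1
    exact hone ▸ N.one_mem
  rw [Finset.mem_compl] at hj
  by_cases hk : ∃ k ∉ S, j ≠ k
  · obtain ⟨k, hk, hjk⟩ := hk
    obtain ⟨M₁, h₁, hM₁, i, hi, hu⟩ := exists_isUnit_col hN hd hj hM
    obtain ⟨M₂, h₂, hM₂, hjj⟩ := exists_apply_self_eq_one hN hi hj hk hjk hM₁ hu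
    obtain ⟨M₃, h₃, hM₃, hcol⟩ := exists_col_eq_one hN hj hM₂ hjj
    obtain ⟨M₄, h₄, hM₄⟩ := exists_isOneOn_insert hN hj hM₃ hcol
    refine h₁ (h₂ (h₃ (h₄ (ih _ (Finset.card_lt_card ?_) _ _ hM₄ rfl))))
    rw [Finset.compl_ssubset_compl]
    exact Finset.ssubset_insert hj
  · push Not at hk
    have hne {k : ι} (h : k ≠ j) : k ∈ S := by
      by_contra hkS
      exact h (hk k hkS).symm
    have hdiag : (M : Matrix ι ι R) = diagonal fun k => M k k := by
      ext a b
      rcases eq_or_ne a b with rfl | hab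
      · simp
      rw [diagonal_apply_ne _ hab]
      by_cases ha : a = j
      · rw [(hM b (hne (ha ▸ hab.symm)) a).2, one_apply_ne hab]
      · rw [(hM a (hne ha) b).1, one_apply_ne hab]
    have hjj : M j j = 1 := by
      have hdet := M.det_coe
      rw [hdiag, det_diagonal, Finset.prod_eq_single j] at hdet
      · exact hdet
      · intro b _ hb
        simpa using (hM b (hne hb) b).1
      · simp
    have hone : M = 1 := by
      ext a b
      rw [hdiag, coe_one, ← diagonal_one]
      congr 1
      ext k
      rcases eq_or_ne k j with rfl | hkj
      · exact hjj
      · simpa using (hM k (hne hkj) k).1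
    exact hone ▸ N.one_mem

/-- Over a ring with a Euclidean algorithm, the special linear group is generated by
transvections. -/
theorem eq_top_of_forall_transvection_mem [Nontrivial R] {d : R → ℕ}
    (hd : ∀ a b : R, b ≠ 0 → ∃ q, a - q * b = 0 ∨ d (a - q * b) < d b) : N = ⊤ :=
  eq_top_iff.2 fun M _ => mem_of_isOneOn hN hd ∅ M (by simp [IsOneOn])

end Reduction

open scoped commutatorElement in
lemma commutatorElement_transvection {i j k : ι} (hij : i ≠ j) (hjk : j ≠ k) (hik : i ≠ k)
    (a b : R) :
    ⁅transvection hij a, transvection hjk b⁆ = transvection hik (a * b) := by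
  rw [commutatorElement_def, mul_inv_eq_iff_eq_mul, mul_inv_eq_iff_eq_mul]
  ext
  simp [transvection_coe, mul_add, add_mul, hjk.symm, hik.symm]
  abel

/-- A normal subgroup containing all transvections with parameter `1` contains every
transvection, provided that there are at least three indices. -/
lemma transvection_mem_of_normal {N : Subgroup (SpecialLinearGroup ι R)} [N.Normal]
    (hN : ∀ (i j : ι) (h : i ≠ j), transvection h (1 : R) ∈ N) (hι : 2 < Fintype.card ι)
    (i j : ι) (h : i ≠ j) (c : R) : transvection h c ∈ N := by
  obtain ⟨k, hki, hkj⟩ : ∃ k, k ≠ i ∧ k ≠ j := by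
    have hlt : ({i, j} : Finset ι).card < Fintype.card ι := Finset.card_le_two.trans_lt hι
    obtain ⟨k, hk⟩ := Finset.exists_mem_notMem_of_card_lt_card (s := {i, j}) (t := Finset.univ)
      (by simpa using hlt)
    exact ⟨k, by simpa using hk⟩
  rw [← one_mul c, ← commutatorElement_transvection hki.symm hkj h, commutatorElement_def,
    mul_assoc, mul_assoc, ← mul_assoc (transvection hkj c)]
  exact N.mul_mem (hN ..) (Subgroup.Normal.conj_mem inferInstance _ (N.inv_mem (hN ..)) _)

end Matrix.SpecialLinearGroup

namespace LaurentPolynomial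

open Polynomial

/-- Division with remainder in `F[t, t⁻¹]`, with respect to the least degree of a polynomial
associated with a given Laurent polynomial. -/
theorem exists_euclidean_norm (F : Type*) [Field F] :
    ∃ d : LaurentPolynomial F → ℕ, ∀ a b : LaurentPolynomial F, b ≠ 0 →
      ∃ q, a - q * b = 0 ∨ d (a - q * b) < d b := by
  let D : LaurentPolynomial F → Set ℕ := fun f =>
    {m | ∃ (p : F[X]) (k : ℤ), f * T k = toLaurent p ∧ p.natDegree = m}
  refine ⟨fun f => sInf (D f), fun a b hb => ?_⟩
  have hD (f : LaurentPolynomial F) : (D f).Nonempty := by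
    obtain ⟨k, p, hp⟩ := f.exists_T_pow
    exact ⟨_, p, k, hp.symm, rfl⟩
  obtain ⟨p, k, hp, hdeg⟩ := Nat.sInf_mem (hD b)
  obtain ⟨m, s, hs⟩ := a.exists_T_pow
  have hp0 : p ≠ 0 := by
    rintro rfl
    rw [map_zero] at hp
    exact hb ((isUnit_T k).mul_left_eq_zero.1 hp)
  have hrem : (a - toLaurent (s / p) * T (k - m) * b) * T m = toLaurent (s % p) := by
    have h1 : (T (k - m) * T m : LaurentPolynomial F) = T k := by
      rw [← T_add, sub_add_cancel]
    rw [EuclideanDomain.mod_eq_sub_mul_div, map_sub, map_mul, hs, ← hp]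
    linear_combination (-toLaurent (s / p) * b) * h1
  refine ⟨toLaurent (s / p) * T (k - m), or_iff_not_imp_left.2 fun hne => ?_⟩
  have hmod : s % p ≠ 0 := by
    intro h0
    rw [h0, map_zero] at hrem
    exact hne ((isUnit_T _).mul_left_eq_zero.1 hrem)
  calc sInf (D _) ≤ (s % p).natDegree := Nat.sInf_le ⟨_, _, hrem, rfl⟩
    _ < p.natDegree := natDegree_lt_natDegree hmod (EuclideanDomain.mod_lt s hp0)
    _ = sInf (D b) := hdeg

end LaurentPolynomial

theorem stmt10 {F : Type*} [Field F] [Finite F] (n : ℕ) (hn : 3 ≤ n) :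
    Subgroup.normalClosure
        (Set.range (⇑(Matrix.SpecialLinearGroup.map (n := Fin n)
          (LaurentPolynomial.C : F →+* LaurentPolynomial F)))) = ⊤ := by
  obtain ⟨d, hd⟩ := LaurentPolynomial.exists_euclidean_norm F
  refine Matrix.SpecialLinearGroup.eq_top_of_forall_transvection_mem
    (Matrix.SpecialLinearGroup.transvection_mem_of_normal (fun i j h => ?_) (by simpa using show 2 < n by omega)) hd
  refine Subgroup.subset_normalClosure ⟨Matrix.SpecialLinearGroup.transvection h 1, ?_⟩
  ext a b
  rw [Matrix.SpecialLinearGroup.map_apply_coe, RingHom.mapMatrix_apply, Matrix.map_apply]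
  simp only [Matrix.SpecialLinearGroup.transvection_coe, Matrix.add_apply, Matrix.one_apply,
    Matrix.single_apply, map_add]
  split_ifs <;> simp
end
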